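/- For every encoding strategy σ at blocklength n, with W1 = (M1,T), W2 = (M2,T) (T uniform on {1,…,n} and independent of everything else), the single-letter best-response sets coincide with the conditional laws induced by operational best responses: Q1(P^σ_{W1W2|U}) = {Q_{V1|W1W2} : there exists τ1 ∈ BR1(σ) such that P^{τ1}_{V1|W1W2} = Q_{V1|W1W2}}, and Q2(P^σ_{W2|U}) = {Q_{V2|W2} : there exists τ2 ∈ BR2(σ) such that P^{τ2}_{V2|W2} = Q_{V2|W2}}. -/

import Mathlib

open scoped BigOperators

namespace Persuasion

/-- `p` is a probability distribution on the finite alphabet `α`. -/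
def IsDist {α : Type*} [Fintype α] (p : α → ℝ) : Prop :=
  (∀ a, 0 ≤ p a) ∧ ∑ a, p a = 1

/-- `k` is a stochastic map (transition kernel) from `α` to `β`. -/
def IsKernel {α : Type*} {β : Type*} [Fintype β] (k : α → β → ℝ) : Prop :=
  ∀ a, IsDist (k a)

/-- Shannon entropy (in bits) of a distribution on a finite alphabet. -/
noncomputable def ent {α : Type*} [Fintype α] (p : α → ℝ) : ℝ :=
  - ∑ a, p a * Real.logb 2 (p a)

/-- Mutual information (in bits) computed from a joint distribution on `α × β`. -/
noncomputable def miOfJoint {α β : Type*} [Fintype α] [Fintype β] (p : α × β → ℝ) : ℝ :=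
  ent (fun a => ∑ b, p (a, b)) + ent (fun b => ∑ a, p (a, b)) - ent p

/-- Message alphabet `{1, …, 2^⌊n·R⌋}` at rate `R` and blocklength `n`. -/
abbrev Msg (R : ℝ) (n : ℕ) : Type := Fin (2 ^ ⌊(n : ℝ) * R⌋₊)

section Operational

variable {U V1 V2 M1 M2 : Type*} [Fintype U] [Fintype V1] [Fintype V2]
  [Fintype M1] [Fintype M2]

/-- Long-run encoder distortion `d_e^n(σ,τ1,τ2)`. -/
noncomputable def deN (PU : U → ℝ) (de : U → V1 → V2 → ℝ) {n : ℕ}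
    (σ : (Fin n → U) → M1 × M2 → ℝ)
    (τ1 : M1 × M2 → (Fin n → V1) → ℝ)
    (τ2 : M2 → (Fin n → V2) → ℝ) : ℝ :=
  ∑ un : Fin n → U, ∑ m1 : M1, ∑ m2 : M2, ∑ v1n : Fin n → V1, ∑ v2n : Fin n → V2,
    ((∏ t, PU (un t)) * σ un (m1, m2) * τ1 (m1, m2) v1n * τ2 m2 v2n) *
      ((n : ℝ)⁻¹ * ∑ t, de (un t) (v1n t) (v2n t))

/-- Long-run distortion `d_1^n(σ,τ1)` of the first decoder. -/
noncomputable def d1N (PU : U → ℝ) (d1 : U → V1 → ℝ) {n : ℕ}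
    (σ : (Fin n → U) → M1 × M2 → ℝ)
    (τ1 : M1 × M2 → (Fin n → V1) → ℝ) : ℝ :=
  ∑ un : Fin n → U, ∑ m1 : M1, ∑ m2 : M2, ∑ v1n : Fin n → V1,
    ((∏ t, PU (un t)) * σ un (m1, m2) * τ1 (m1, m2) v1n) *
      ((n : ℝ)⁻¹ * ∑ t, d1 (un t) (v1n t))

/-- Long-run distortion `d_2^n(σ,τ2)` of the second decoder. -/
noncomputable def d2N (PU : U → ℝ) (d2 : U → V2 → ℝ) {n : ℕ}
    (σ : (Fin n → U) → M1 × M2 → ℝ)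
    (τ2 : M2 → (Fin n → V2) → ℝ) : ℝ :=
  ∑ un : Fin n → U, ∑ m1 : M1, ∑ m2 : M2, ∑ v2n : Fin n → V2,
    ((∏ t, PU (un t)) * σ un (m1, m2) * τ2 m2 v2n) *
      ((n : ℝ)⁻¹ * ∑ t, d2 (un t) (v2n t))

/-- Best responses of decoder 1 to the encoding strategy `σ`. -/
def BR1 (PU : U → ℝ) (d1 : U → V1 → ℝ) {n : ℕ}
    (σ : (Fin n → U) → M1 × M2 → ℝ) :
    Set (M1 × M2 → (Fin n → V1) → ℝ) :=
  {τ1 | IsKernel τ1 ∧ ∀ τ1' : M1 × M2 → (Fin n → V1) → ℝ,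
      IsKernel τ1' → d1N PU d1 σ τ1 ≤ d1N PU d1 σ τ1'}

/-- Best responses of decoder 2 to the encoding strategy `σ`. -/
def BR2 (PU : U → ℝ) (d2 : U → V2 → ℝ) {n : ℕ}
    (σ : (Fin n → U) → M1 × M2 → ℝ) :
    Set (M2 → (Fin n → V2) → ℝ) :=
  {τ2 | IsKernel τ2 ∧ ∀ τ2' : M2 → (Fin n → V2) → ℝ,
      IsKernel τ2' → d2N PU d2 σ τ2 ≤ d2N PU d2 σ τ2'}

/-- Worst-case encoder distortion over the best responses of the two decoders. -/
noncomputable def DeWorst (PU : U → ℝ) (de : U → V1 → V2 → ℝ) (d1 : U → V1 → ℝ)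
    (d2 : U → V2 → ℝ) {n : ℕ} (σ : (Fin n → U) → M1 × M2 → ℝ) : ℝ :=
  sSup {y | ∃ τ1 ∈ BR1 PU d1 σ, ∃ τ2 ∈ BR2 PU d2 σ, y = deN PU de σ τ1 τ2}

end Operational

/-- Optimal `n`-letter encoder distortion `D_e^n(R1,R2)`. -/
noncomputable def Dn {U V1 V2 : Type*} [Fintype U] [Fintype V1] [Fintype V2]
    (PU : U → ℝ) (de : U → V1 → V2 → ℝ) (d1 : U → V1 → ℝ) (d2 : U → V2 → ℝ)
    (R1 R2 : ℝ) (n : ℕ) : ℝ :=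
  sInf {x | ∃ σ : (Fin n → U) → Msg R1 n × Msg R2 n → ℝ, IsKernel σ ∧
    x = DeWorst PU de d1 d2 σ}

section SingleLetter

variable {U V1 V2 W1 W2 : Type*} [Fintype U] [Fintype V1] [Fintype V2]
  [Fintype W1] [Fintype W2]

/-- The information-constraint set `Q0(R1,R2)` of conditional distributions. -/
noncomputable def Q0set (PU : U → ℝ) (R1 R2 : ℝ) : Set (U → W1 × W2 → ℝ) :=
  {Q | IsKernel Q ∧
    miOfJoint (fun p : U × W2 => ∑ w1, PU p.1 * Q p.1 (w1, p.2)) ≤ R2 ∧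
    miOfJoint (fun p : U × (W1 × W2) => PU p.1 * Q p.1 p.2) ≤ R1 + R2}

/-- Expected distortion `E[d_1(U,V1)]` under `P_U · Q_{W1W2|U} · Q_{V1|W1W2}`. -/
noncomputable def E1 (PU : U → ℝ) (d1 : U → V1 → ℝ) (Q : U → W1 × W2 → ℝ)
    (k1 : W1 × W2 → V1 → ℝ) : ℝ :=
  ∑ u, ∑ w : W1 × W2, ∑ v1, PU u * Q u w * k1 w v1 * d1 u v1

/-- Expected distortion `E[d_2(U,V2)]` under `P_U · Q_{W2|U} · Q_{V2|W2}`. -/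
noncomputable def E2 (PU : U → ℝ) (d2 : U → V2 → ℝ) (Q : U → W1 × W2 → ℝ)
    (k2 : W2 → V2 → ℝ) : ℝ :=
  ∑ u, ∑ w2 : W2, ∑ v2, PU u * (∑ w1, Q u (w1, w2)) * k2 w2 v2 * d2 u v2

/-- Single-letter best responses `Q1(Q_{W1W2|U})` of decoder 1. -/
def Q1set (PU : U → ℝ) (d1 : U → V1 → ℝ) (Q : U → W1 × W2 → ℝ) :
    Set (W1 × W2 → V1 → ℝ) :=
  {k1 | IsKernel k1 ∧ ∀ k1' : W1 × W2 → V1 → ℝ, IsKernel k1' →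
      E1 PU d1 Q k1 ≤ E1 PU d1 Q k1'}

/-- Single-letter best responses `Q2(Q_{W2|U})` of decoder 2. -/
def Q2set (PU : U → ℝ) (d2 : U → V2 → ℝ) (Q : U → W1 × W2 → ℝ) :
    Set (W2 → V2 → ℝ) :=
  {k2 | IsKernel k2 ∧ ∀ k2' : W2 → V2 → ℝ, IsKernel k2' →
      E2 PU d2 Q k2 ≤ E2 PU d2 Q k2'}

/-- Expected encoder distortion `E[d_e(U,V1,V2)]` under
`P_U · Q_{W1W2|U} · Q_{V1|W1W2} · Q_{V2|W2}`. -/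
noncomputable def Ee (PU : U → ℝ) (de : U → V1 → V2 → ℝ) (Q : U → W1 × W2 → ℝ)
    (k1 : W1 × W2 → V1 → ℝ) (k2 : W2 → V2 → ℝ) : ℝ :=
  ∑ u, ∑ w : W1 × W2, ∑ v1, ∑ v2,
    PU u * Q u w * k1 w v1 * k2 w.2 v2 * de u v1 v2

end SingleLetter

/-- Single-letter optimal encoder distortion `D_e*(R1,R2)`, with auxiliary
alphabets `W1`, `W2`. -/
noncomputable def Dstar (W1 W2 : Type*) [Fintype W1] [Fintype W2]
    {U V1 V2 : Type*} [Fintype U] [Fintype V1] [Fintype V2]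
    (PU : U → ℝ) (de : U → V1 → V2 → ℝ) (d1 : U → V1 → ℝ) (d2 : U → V2 → ℝ)
    (R1 R2 : ℝ) : ℝ :=
  sInf {x | ∃ Q : U → W1 × W2 → ℝ, Q ∈ Q0set PU R1 R2 ∧
    x = sSup {y | ∃ k1 ∈ Q1set PU d1 Q, ∃ k2 ∈ Q2set PU d2 Q,
      y = Ee PU de Q k1 k2}}


section BRCharacterization

variable {U V1 V2 M1 M2 : Type*} [Fintype U] [Fintype V1] [Fintype V2]
  [Fintype M1] [Fintype M2] [DecidableEq U] [DecidableEq V1] [DecidableEq V2]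

/-- Joint distribution of `(U_T, (M1,T), (M2,T))`, with `T` uniform on
`{1,…,n}` and independent of everything else. -/
noncomputable def slJointUW (PU : U → ℝ) {n : ℕ}
    (σ : (Fin n → U) → M1 × M2 → ℝ)
    (u : U) (w : (M1 × Fin n) × (M2 × Fin n)) : ℝ :=
  if w.1.2 = w.2.2 then
    (n : ℝ)⁻¹ * ∑ un : Fin n → U,
      (if un w.1.2 = u then (∏ t, PU (un t)) * σ un (w.1.1, w.2.1) else 0)
  else 0

/-- Joint distribution of `((M1,T),(M2,T), V_{1,T})` under `P^{σ,τ1}`. -/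
noncomputable def slJointWV1 (PU : U → ℝ) {n : ℕ}
    (σ : (Fin n → U) → M1 × M2 → ℝ)
    (τ1 : M1 × M2 → (Fin n → V1) → ℝ)
    (w : (M1 × Fin n) × (M2 × Fin n)) (v1 : V1) : ℝ :=
  if w.1.2 = w.2.2 then
    (n : ℝ)⁻¹ * ∑ un : Fin n → U, ∑ v1n : Fin n → V1,
      (if v1n w.1.2 = v1 then
        (∏ t, PU (un t)) * σ un (w.1.1, w.2.1) * τ1 (w.1.1, w.2.1) v1n else 0)
  else 0

/-- Joint distribution of `((M2,T), V_{2,T})` under `P^{σ,τ2}`. -/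
noncomputable def slJointW2V2 (PU : U → ℝ) {n : ℕ}
    (σ : (Fin n → U) → M1 × M2 → ℝ)
    (τ2 : M2 → (Fin n → V2) → ℝ)
    (w2 : M2 × Fin n) (v2 : V2) : ℝ :=
  (n : ℝ)⁻¹ * ∑ un : Fin n → U, ∑ m1 : M1, ∑ v2n : Fin n → V2,
    (if v2n w2.2 = v2 then
      (∏ t, PU (un t)) * σ un (m1, w2.1) * τ2 w2.1 v2n else 0)

/-- Single-letter best responses of decoder 1, phrased directly in terms of the
joint law `p_{U,W1,W2}` (this is `Q1(Q_{W1W2|U})` with `P_U·Q_{W1W2|U} = p`). -/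
def Q1setJ {W : Type*} [Fintype W] (d1 : U → V1 → ℝ) (p : U → W → ℝ) :
    Set (W → V1 → ℝ) :=
  {k1 | IsKernel k1 ∧ ∀ k1' : W → V1 → ℝ, IsKernel k1' →
    (∑ u, ∑ w, ∑ v1, p u w * k1 w v1 * d1 u v1) ≤
      (∑ u, ∑ w, ∑ v1, p u w * k1' w v1 * d1 u v1)}

/-- Single-letter best responses of decoder 2, phrased via the joint law. -/
def Q2setJ {W : Type*} [Fintype W] (d2 : U → V2 → ℝ) (p : U → W → ℝ) :
    Set (W → V2 → ℝ) :=
  {k2 | IsKernel k2 ∧ ∀ k2' : W → V2 → ℝ, IsKernel k2' →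
    (∑ u, ∑ w, ∑ v2, p u w * k2 w v2 * d2 u v2) ≤
      (∑ u, ∑ w, ∑ v2, p u w * k2' w v2 * d2 u v2)}

section Core

variable {U V M : Type*} [Fintype U] [Fintype V] [Fintype M] [DecidableEq U] [DecidableEq V]
  {n : ℕ}

/-- abstract long-run distortion -/
noncomputable def coreD (d : U → V → ℝ) (s : (Fin n → U) → M → ℝ)
    (τ : M → (Fin n → V) → ℝ) : ℝ :=
  ∑ un : Fin n → U, ∑ m, ∑ vn : Fin n → V, s un m * τ m vn * ∑ t, d (un t) (vn t)

/-- abstract single-letter distortion -/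
noncomputable def coreJ (d : U → V → ℝ) (s : (Fin n → U) → M → ℝ)
    (K : M → Fin n → V → ℝ) : ℝ :=
  ∑ m, ∑ t, ∑ v, (∑ un : Fin n → U, s un m * d (un t) v) * K m t v

/-- time marginals of a strategy -/
noncomputable def marg (τ : M → (Fin n → V) → ℝ) (m : M) (t : Fin n) (v : V) : ℝ :=
  ∑ vn : Fin n → V, if vn t = v then τ m vn else 0

/-- product strategy -/
noncomputable def prodK (K : M → Fin n → V → ℝ) (m : M) (vn : Fin n → V) : ℝ :=
  ∏ t, K m t (vn t)

lemma prodK_kernel (K : M → Fin n → V → ℝ) (hK : ∀ m, IsKernel (K m)) :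
    IsKernel (prodK K) := by
  intro m
  refine ⟨fun vn => Finset.prod_nonneg fun t _ => (hK m t).1 _, ?_⟩
  have h := Finset.prod_univ_sum (fun _ : Fin n => (Finset.univ : Finset V)) (fun t v => K m t v)
  rw [Fintype.piFinset_univ] at h
  simp only [prodK]
  rw [← h]
  exact Finset.prod_eq_one fun t _ => (hK m t).2

lemma marg_kernel (τ : M → (Fin n → V) → ℝ) (hτ : IsKernel τ) (m : M) :
    IsKernel (marg τ m) := by
  intro t
  refine ⟨fun v => Finset.sum_nonneg fun vn _ => ?_, ?_⟩
  · split_ifs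
    · exact (hτ m).1 _
    · exact le_rfl
  · simp only [marg]
    rw [Finset.sum_comm]
    simpa using (hτ m).2

lemma marg_prodK (K : M → Fin n → V → ℝ) (hK : ∀ m, IsKernel (K m)) :
    marg (prodK K) = K := by
  funext m t v
  have h := Finset.prod_univ_sum (fun _ : Fin n => (Finset.univ : Finset V))
    (fun t' v' => if t' = t then (if v' = v then K m t' v' else 0) else K m t' v')
  rw [Fintype.piFinset_univ] at h
  have h1 : ∀ vn : Fin n → V, (if vn t = v then prodK K m vn else 0) =
      ∏ t', (if t' = t then (if vn t' = v then K m t' (vn t') else 0) else K m t' (vn t')) := by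
    intro vn
    by_cases hv : vn t = v
    · rw [if_pos hv]
      refine Finset.prod_congr rfl fun t' _ => ?_
      by_cases ht : t' = t
      · subst ht; simp [hv]
      · simp [ht]
    · rw [if_neg hv]
      symm
      exact Finset.prod_eq_zero (Finset.mem_univ t) (by simp [hv])
  simp only [marg]
  rw [Finset.sum_congr rfl fun vn _ => h1 vn, ← h, Finset.prod_eq_single t]
  · simp
  · intro b _ hb
    simpa [hb] using (hK m b).2
  · simp

lemma coreD_eq (d : U → V → ℝ) (s : (Fin n → U) → M → ℝ) (τ : M → (Fin n → V) → ℝ) :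
    coreD d s τ = coreJ d s (marg τ) := by
  simp only [coreD, coreJ, marg]
  rw [Finset.sum_comm]
  refine Finset.sum_congr rfl fun m _ => ?_
  have h : ∀ t : Fin n, ∑ v, (∑ un : Fin n → U, s un m * d (un t) v) *
      (∑ vn : Fin n → V, if vn t = v then τ m vn else 0) =
      ∑ un : Fin n → U, ∑ vn : Fin n → V, s un m * τ m vn * d (un t) (vn t) := by
    intro t
    simp only [Finset.mul_sum]
    rw [Finset.sum_comm]
    conv_rhs => rw [Finset.sum_comm]
    refine Finset.sum_congr rfl fun vn _ => ?_
    simp only [mul_ite, mul_zero, Finset.sum_ite_eq, Finset.mem_univ, if_true]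
    rw [Finset.sum_mul]
    exact Finset.sum_congr rfl fun un _ => by ring
  rw [Finset.sum_congr rfl fun t _ => h t]
  conv_rhs => rw [Finset.sum_comm]
  refine Finset.sum_congr rfl fun un _ => ?_
  conv_rhs => rw [Finset.sum_comm]
  exact Finset.sum_congr rfl fun vn _ => Finset.mul_sum ..

lemma core (d : U → V → ℝ) (s : (Fin n → U) → M → ℝ) (hs : ∀ un m, 0 ≤ s un m)
    (K : M → Fin n → V → ℝ) (hK : ∀ m, IsKernel (K m)) :
    (∀ K' : M → Fin n → V → ℝ, (∀ m, IsKernel (K' m)) → coreJ d s K ≤ coreJ d s K') ↔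
    ∃ τ : M → (Fin n → V) → ℝ, (IsKernel τ ∧
      ∀ τ' : M → (Fin n → V) → ℝ, IsKernel τ' → coreD d s τ ≤ coreD d s τ') ∧
      ∀ m t v, (∑ un, s un m) * K m t v = (∑ un, s un m) * marg τ m t v := by
  constructor
  · intro h
    refine ⟨prodK K, ⟨prodK_kernel K hK, fun τ' hτ' => ?_⟩, ?_⟩
    · rw [coreD_eq, coreD_eq, marg_prodK K hK]
      exact h _ (marg_kernel τ' hτ')
    · rw [marg_prodK K hK]; intros; rfl
  · rintro ⟨τ, ⟨hτ, hopt⟩, hm⟩ K' hK'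
    have e : coreJ d s K = coreD d s τ := by
      rw [coreD_eq]
      refine Finset.sum_congr rfl fun m _ => Finset.sum_congr rfl fun t _ =>
        Finset.sum_congr rfl fun v _ => ?_
      by_cases h0 : ∑ un, s un m = 0
      · have hz := (Finset.sum_eq_zero_iff_of_nonneg fun un _ => hs un m).1 h0
        have : ∑ un : Fin n → U, s un m * d (un t) v = 0 :=
          Finset.sum_eq_zero fun un hu => by rw [hz un hu, zero_mul]
        rw [this, zero_mul, zero_mul]
      · rw [mul_left_cancel₀ h0 (hm m t v)]
    have := hopt _ (prodK_kernel K' hK')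
    rw [coreD_eq d s (prodK K'), marg_prodK K' hK'] at this
    rw [e]; exact this

lemma single (d : U → V → ℝ) (s : (Fin n → U) → M → ℝ) (m : M) (t : Fin n) (c : ℝ) (v : V) :
    ∑ u, (∑ un : Fin n → U, if un t = u then s un m else 0) * c * d u v =
      (∑ un : Fin n → U, s un m * d (un t) v) * c := by
  simp only [Finset.sum_mul]
  rw [Finset.sum_comm]
  refine Finset.sum_congr rfl fun un _ => ?_
  simp only [ite_mul, zero_mul, Finset.sum_ite_eq, Finset.mem_univ, if_true]
  ring

lemma singleJ (d : U → V → ℝ) (s : (Fin n → U) → M → ℝ) (K : M → Fin n → V → ℝ) :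
    ∑ u, ∑ m, ∑ t, ∑ v, (∑ un : Fin n → U, if un t = u then s un m else 0) * K m t v * d u v =
      coreJ d s K := by
  simp only [coreJ, ← single]
  rw [Finset.sum_comm]
  refine Finset.sum_congr rfl fun m _ => ?_
  rw [Finset.sum_comm]
  refine Finset.sum_congr rfl fun t _ => ?_
  rw [Finset.sum_comm]

lemma single_mass (s : (Fin n → U) → M → ℝ) (m : M) (t : Fin n) :
    ∑ u, (∑ un : Fin n → U, if un t = u then s un m else 0) = ∑ un, s un m := by
  rw [Finset.sum_comm]
  simp

lemma marg_mass (s : (Fin n → U) → M → ℝ) (τ : M → (Fin n → V) → ℝ) (m : M) (t : Fin n) (v : V) :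
    ∑ un : Fin n → U, ∑ vn : Fin n → V, (if vn t = v then s un m * τ m vn else 0) =
      (∑ un, s un m) * marg τ m t v := by
  simp only [marg]
  rw [Finset.sum_mul_sum]
  simp only [mul_ite, mul_zero]

end Core

/-- weights for decoder 1 -/
noncomputable def s1 (PU : U → ℝ) {n : ℕ} (σ : (Fin n → U) → M1 × M2 → ℝ)
    (un : Fin n → U) (m : M1 × M2) : ℝ :=
  (n : ℝ)⁻¹ * ((∏ t, PU (un t)) * σ un m)

/-- weights for decoder 2 -/
noncomputable def s2 (PU : U → ℝ) {n : ℕ} (σ : (Fin n → U) → M1 × M2 → ℝ)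
    (un : Fin n → U) (m : M2) : ℝ :=
  ∑ m1 : M1, s1 PU σ un (m1, m)

lemma s1_nonneg (PU : U → ℝ) (hPU : IsDist PU) {n : ℕ} (σ : (Fin n → U) → M1 × M2 → ℝ)
    (hσ : IsKernel σ) (un : Fin n → U) (m : M1 × M2) : 0 ≤ s1 PU σ un m :=
  mul_nonneg (by positivity)
    (mul_nonneg (Finset.prod_nonneg fun t _ => hPU.1 _) ((hσ un).1 m))

lemma d1N_eq (PU : U → ℝ) (d1 : U → V1 → ℝ) {n : ℕ} (σ : (Fin n → U) → M1 × M2 → ℝ)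
    (τ : M1 × M2 → (Fin n → V1) → ℝ) : d1N PU d1 σ τ = coreD d1 (s1 PU σ) τ := by
  simp only [d1N, coreD, s1, Fintype.sum_prod_type]
  refine Finset.sum_congr rfl fun un _ => Finset.sum_congr rfl fun m1 _ =>
    Finset.sum_congr rfl fun m2 _ => Finset.sum_congr rfl fun vn _ => ?_
  ring

lemma d2N_eq (PU : U → ℝ) (d2 : U → V2 → ℝ) {n : ℕ} (σ : (Fin n → U) → M1 × M2 → ℝ)
    (τ : M2 → (Fin n → V2) → ℝ) : d2N PU d2 σ τ = coreD d2 (s2 PU σ) τ := by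
  simp only [d2N, coreD, s2, s1]
  refine Finset.sum_congr rfl fun un _ => ?_
  rw [Finset.sum_comm]
  refine Finset.sum_congr rfl fun m2 _ => ?_
  rw [Finset.sum_comm]
  refine Finset.sum_congr rfl fun vn _ => ?_
  simp only [Finset.sum_mul]
  refine Finset.sum_congr rfl fun m1 _ => ?_
  ring

lemma slUW_eq (PU : U → ℝ) {n : ℕ} (σ : (Fin n → U) → M1 × M2 → ℝ) (u : U)
    (m1 : M1) (m2 : M2) (t t' : Fin n) :
    slJointUW PU σ u ((m1, t), (m2, t')) =
      if t = t' then ∑ un : Fin n → U, (if un t = u then s1 PU σ un (m1, m2) else 0) else 0 := by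
  simp only [slJointUW, s1, Finset.mul_sum, mul_ite, mul_zero]

lemma slUW2_eq (PU : U → ℝ) {n : ℕ} (σ : (Fin n → U) → M1 × M2 → ℝ) (u : U)
    (m2 : M2) (t : Fin n) :
    ∑ w1 : M1 × Fin n, slJointUW PU σ u (w1, (m2, t)) =
      ∑ un : Fin n → U, (if un t = u then s2 PU σ un m2 else 0) := by
  simp only [Fintype.sum_prod_type, slUW_eq, Finset.sum_ite_eq', Finset.mem_univ, if_true]
  rw [Finset.sum_comm]
  refine Finset.sum_congr rfl fun un _ => ?_
  split_ifs <;> simp [s2]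

lemma slWV1_eq (PU : U → ℝ) {n : ℕ} (σ : (Fin n → U) → M1 × M2 → ℝ)
    (τ : M1 × M2 → (Fin n → V1) → ℝ) (m1 : M1) (m2 : M2) (t t' : Fin n) (v : V1) :
    slJointWV1 PU σ τ ((m1, t), (m2, t')) v =
      if t = t' then (∑ un, s1 PU σ un (m1, m2)) * marg τ (m1, m2) t v else 0 := by
  rw [← marg_mass]
  simp only [slJointWV1, s1, Finset.mul_sum, mul_ite, mul_zero, mul_assoc]

lemma slWV2_eq (PU : U → ℝ) {n : ℕ} (σ : (Fin n → U) → M1 × M2 → ℝ)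
    (τ : M2 → (Fin n → V2) → ℝ) (m2 : M2) (t : Fin n) (v : V2) :
    slJointW2V2 PU σ τ (m2, t) v = (∑ un, s2 PU σ un m2) * marg τ m2 t v := by
  rw [← marg_mass]
  simp only [slJointW2V2, Finset.mul_sum]
  refine Finset.sum_congr rfl fun un _ => ?_
  rw [Finset.sum_comm]
  refine Finset.sum_congr rfl fun vn _ => ?_
  split_ifs
  · simp only [s2, s1, Finset.sum_mul, mul_assoc]
  · simp

lemma E1_eq (PU : U → ℝ) (d1 : U → V1 → ℝ) {n : ℕ} (σ : (Fin n → U) → M1 × M2 → ℝ)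
    (k : (M1 × Fin n) × (M2 × Fin n) → V1 → ℝ) :
    (∑ u, ∑ w, ∑ v1, slJointUW PU σ u w * k w v1 * d1 u v1) =
      coreJ d1 (s1 PU σ) (fun m t v => k ((m.1, t), (m.2, t)) v) := by
  rw [← singleJ]
  refine Finset.sum_congr rfl fun u _ => ?_
  simp only [Fintype.sum_prod_type]
  refine Finset.sum_congr rfl fun m1 _ => ?_
  rw [Finset.sum_comm]
  refine Finset.sum_congr rfl fun m2 _ => Finset.sum_congr rfl fun t _ => ?_
  rw [Finset.sum_eq_single t]
  · simp [slUW_eq]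
  · intro b _ hb
    simp [slUW_eq, Ne.symm hb]
  · simp

lemma E2_eq (PU : U → ℝ) (d2 : U → V2 → ℝ) {n : ℕ} (σ : (Fin n → U) → M1 × M2 → ℝ)
    (k : M2 × Fin n → V2 → ℝ) :
    (∑ u, ∑ w : M2 × Fin n, ∑ v2, (∑ w1 : M1 × Fin n, slJointUW PU σ u (w1, w)) * k w v2 * d2 u v2)
      = coreJ d2 (s2 PU σ) (fun m t v => k (m, t) v) := by
  rw [← singleJ]
  simp only [Fintype.sum_prod_type (f := fun w : M2 × Fin n => ∑ v2, _), slUW2_eq]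

/-- the single-letter best-response sets of the induced
conditional `P^σ_{W1W2|U}` (resp. `P^σ_{W2|U}`) coincide with the conditional
laws `P^{τ_i}_{V_i|·}` induced by operational best responses `τ_i ∈ BR_i(σ)`. -/
theorem stmt8_br_characterization
    (PU : U → ℝ) (hPU : IsDist PU)
    (d1 : U → V1 → ℝ) (d2 : U → V2 → ℝ)
    (n : ℕ) (hn : 1 ≤ n)
    (σ : (Fin n → U) → M1 × M2 → ℝ) (hσ : IsKernel σ) :
    Q1setJ d1 (slJointUW PU σ) =
      {k1 : (M1 × Fin n) × (M2 × Fin n) → V1 → ℝ | IsKernel k1 ∧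
        ∃ τ1 ∈ BR1 PU d1 σ, ∀ w v1,
          (∑ u, slJointUW PU σ u w) * k1 w v1 = slJointWV1 PU σ τ1 w v1} ∧
    Q2setJ d2 (fun u (w2 : M2 × Fin n) =>
        ∑ w1 : M1 × Fin n, slJointUW PU σ u (w1, w2)) =
      {k2 : M2 × Fin n → V2 → ℝ | IsKernel k2 ∧
        ∃ τ2 ∈ BR2 PU d2 σ, ∀ w2 v2,
          (∑ u, ∑ w1 : M1 × Fin n, slJointUW PU σ u (w1, w2)) * k2 w2 v2 =
            slJointW2V2 PU σ τ2 w2 v2} := by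
  constructor
  · ext k
    simp only [Q1setJ, BR1, Set.mem_setOf_eq, E1_eq, d1N_eq]
    refine and_congr_right fun hk => ?_
    refine Iff.trans ?_ ((core d1 (s1 PU σ) (s1_nonneg PU hPU σ hσ)
      (fun m t v => k ((m.1, t), (m.2, t)) v) (fun m t => hk _)).trans ?_)
    · constructor
      · intro h K' hK'
        exact h (fun w v => K' (w.1.1, w.2.1) w.1.2 v) (fun w => hK' _ _)
      · intro h k' hk'
        exact h _ (fun m t => hk' _)
    · refine exists_congr fun τ => and_congr_right fun _ => ?_
      constructor
      · rintro h ⟨⟨m1, t⟩, ⟨m2, t'⟩⟩ v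
        simp only [slUW_eq, slWV1_eq]
        by_cases ht : t = t'
        · subst ht
          simp only [if_true, single_mass]
          exact h (m1, m2) t v
        · simp [ht]
      · rintro h ⟨m1, m2⟩ t v
        have := h ((m1, t), (m2, t)) v
        simpa only [slUW_eq, slWV1_eq, if_true, single_mass] using this
  · ext k
    simp only [Q2setJ, BR2, Set.mem_setOf_eq, E2_eq, d2N_eq]
    refine and_congr_right fun hk => ?_
    refine Iff.trans ?_ ((core d2 (s2 PU σ)
      (fun un m => Finset.sum_nonneg fun m1 _ => s1_nonneg PU hPU σ hσ un (m1, m))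
      (fun m t v => k (m, t) v) (fun m t => hk _)).trans ?_)
    · constructor
      · intro h K' hK'
        exact h (fun w v => K' w.1 w.2 v) (fun w => hK' _ _)
      · intro h k' hk'
        exact h _ (fun m t => hk' _)
    · refine exists_congr fun τ => and_congr_right fun _ => ?_
      constructor
      · rintro h ⟨m2, t⟩ v
        simp only [slUW2_eq, slWV2_eq, single_mass]
        exact h m2 t v
      · rintro h m2 t v
        have := h (m2, t) v
        simpa only [slUW2_eq, slWV2_eq, single_mass] using this


end BRCharacterization

end Persuasion
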